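/- (Pivot Theorem) Let x, y, z be distinct E-vertices of a D-graph. If ψ_E(x,y,z) and ψ_E(y,x,z), then there is a vertex v such that v ▷ [z,x], v ▷ [z,y], v ≺ x and v ≺ y. -/

import Mathlib

/-- A graph in the sense of the paper: a finite set of edges, a finite set of
vertices, and West/East end functions (values outside `A` are irrelevant junk,
canonically `0`). -/
structure DGr where
  A : Finset ℕ
  V : Finset ℕ
  W : ℕ → ℕ
  E : ℕ → ℕ

namespace DGr

/-- The `X`-end function of a graph: `true` stands for `W`, `false` for `E`. -/
def Xf (G : DGr) : Bool → ℕ → ℕ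
  | true => G.W
  | false => G.E

/-- `vs`/`es` form a semiwalk: alternating vertices and edges, each edge joining
its two neighbouring vertices in one of the two directions. -/
def IsSemiwalk (G : DGr) (vs es : List ℕ) : Prop :=
  vs.length = es.length + 1 ∧
  (∀ v ∈ vs, v ∈ G.V) ∧ (∀ a ∈ es, a ∈ G.A) ∧
  ∀ (i a u v : ℕ), es[i]? = some a → vs[i]? = some u → vs[i + 1]? = some v →
    (G.W a = u ∧ G.E a = v) ∨ (G.W a = v ∧ G.E a = u)

/-- A semipath is a semiwalk with no repeated vertex. -/
def IsSemipath (G : DGr) (vs es : List ℕ) : Prop :=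
  G.IsSemiwalk vs es ∧ vs.Nodup

/-- A semipath from `u` to `v`. -/
def SemipathFT (G : DGr) (u v : ℕ) (vs es : List ℕ) : Prop :=
  G.IsSemipath vs es ∧ vs.head? = some u ∧ vs.getLast? = some v

/-- A walk: all edges traversed from West to East. -/
def IsWalk (G : DGr) (vs es : List ℕ) : Prop :=
  vs.length = es.length + 1 ∧
  (∀ v ∈ vs, v ∈ G.V) ∧ (∀ a ∈ es, a ∈ G.A) ∧
  ∀ (i a u v : ℕ), es[i]? = some a → vs[i]? = some u → vs[i + 1]? = some v →
    G.W a = u ∧ G.E a = v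

/-- A cycle: a non-trivial closed walk with no repeated vertex except endpoints. -/
def IsCycle (G : DGr) (vs es : List ℕ) : Prop :=
  G.IsWalk vs es ∧ es ≠ [] ∧ vs.head? = vs.getLast? ∧ vs.dropLast.Nodup

def Acyclic (G : DGr) : Prop := ∀ vs es, ¬ G.IsCycle vs es

def WeaklyConnected (G : DGr) : Prop :=
  ∀ u ∈ G.V, ∀ v ∈ G.V, u ≠ v → ∃ vs es, G.SemipathFT u v vs es

/-- `v` is an `X`-vertex: no edge has its `X̄`-end at `v`. -/
def XVertex (G : DGr) (X : Bool) (v : ℕ) : Prop :=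
  v ∈ G.V ∧ ∀ a ∈ G.A, G.Xf (!X) a ≠ v

def InnerVertex (G : DGr) (v : ℕ) : Prop :=
  v ∈ G.V ∧ ¬ G.XVertex true v ∧ ¬ G.XVertex false v

/-- `a` is an `X`-edge: its `X`-end is an `X`-vertex. -/
def XEdge (G : DGr) (X : Bool) (a : ℕ) : Prop :=
  a ∈ G.A ∧ G.XVertex X (G.Xf X a)

def InnerEdge (G : DGr) (a : ℕ) : Prop :=
  a ∈ G.A ∧ ¬ G.XEdge true a ∧ ¬ G.XEdge false a

def WEFunctional (G : DGr) : Prop :=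
  ∀ (X : Bool) (a : ℕ), G.XEdge X a → ∀ b ∈ G.A, b ≠ a → G.Xf X b ≠ G.Xf X a

def WellFormed (G : DGr) : Prop := ∀ a ∈ G.A, G.W a ∈ G.V ∧ G.E a ∈ G.V

/-- A D-graph: finite (built in), acyclic, W-E-functional, weakly connected
graph with an inner vertex. -/
def IsDGraph (G : DGr) : Prop :=
  G.WellFormed ∧ G.Acyclic ∧ G.WEFunctional ∧ G.WeaklyConnected ∧ ∃ v, G.InnerVertex v

/-- A basic D-graph: a D-graph with a single inner vertex. -/
def IsBasicDGraph (G : DGr) : Prop :=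
  G.IsDGraph ∧ ∃! v, G.InnerVertex v

/-- `ψ_X(v,u,w)`: every semipath in `[v,w]` and every semipath in `[u]_{X̄}`
intersect. -/
def psi (G : DGr) (X : Bool) (v u w : ℕ) : Prop :=
  ∀ vs₁ es₁, G.SemipathFT v w vs₁ es₁ →
    ∀ t vs₂ es₂, G.XVertex (!X) t → G.SemipathFT u t vs₂ es₂ →
      ∃ z, z ∈ vs₁ ∧ z ∈ vs₂

/-- `y ▷ [x,z]`: `y` occurs in every semipath from `x` to `z`. -/
def inAll (G : DGr) (y x z : ℕ) : Prop :=
  ∀ vs es, G.SemipathFT x z vs es → y ∈ vs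

/-- `y ≺ x`: `y` is a pivot of `x` (`y` occurs in every semipath in `[x]_W`). -/
def Pivot (G : DGr) (y x : ℕ) : Prop :=
  y ≠ x ∧ ∀ t vs es, G.XVertex true t → G.SemipathFT x t vs es → y ∈ vs

/-- `y ≺_∃ x`: `y` occurs in some semipath in `[x]_W`. -/
def PivotE (G : DGr) (y x : ℕ) : Prop :=
  y ≠ x ∧ ∃ t vs es, G.XVertex true t ∧ G.SemipathFT x t vs es ∧ y ∈ vs

/-- `v CCP(x,y)`: `v` is the closest common pivot of `x` and `y`. -/
def CCP (G : DGr) (v x y : ℕ) : Prop :=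
  G.Pivot v x ∧ G.Pivot v y ∧ ∀ w, G.Pivot w x → G.Pivot w y → (G.Pivot w v ∨ w = v)

end DGr

namespace DGr

inductive Rch (adj : ℕ → ℕ → Prop) (S A : Set ℕ) : ℕ → Prop
  | base (s : ℕ) : s ∈ S → s ∈ A → Rch adj S A s
  | step (u v : ℕ) : Rch adj S A u → adj u v → v ∈ A → Rch adj S A v

section abs
variable {adj : ℕ → ℕ → Prop}

theorem Rch.mem {S A : Set ℕ} {v : ℕ} (h : Rch adj S A v) : v ∈ A := by
  cases h <;> assumption

theorem Rch.mono {S S' A A' : Set ℕ} {v : ℕ} (h : Rch adj S A v) (hS : S ⊆ S') (hA : A ⊆ A') :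
    Rch adj S' A' v := by
  induction h with
  | base s h1 h2 => exact .base s (hS h1) (hA h2)
  | step u v _ h2 h3 ih => exact .step u v ih h2 (hA h3)

theorem Rch.self {S A : Set ℕ} {v : ℕ} (h : Rch adj S A v) :
    Rch adj S {u | Rch adj S A u} v := by
  induction h with
  | base s h1 h2 => exact .base s h1 (Rch.base s h1 h2)
  | step u v h1 h2 h3 ih => exact .step u v ih h2 (Rch.step u v h1 h2 h3)

theorem Rch.back (hs : ∀ a b, adj a b → adj b a) {A : Set ℕ} {u v : ℕ} (h : Rch adj {u} A v) :
    ∀ S, Rch adj S A v → Rch adj S A u := by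
  induction h with
  | base s h1 h2 => intro S h; rw [Set.mem_singleton_iff] at h1; rwa [← h1]
  | step w v h1 h2 h3 ih => exact fun S h => ih S (.step v w h (hs _ _ h2) h1.mem)

theorem Rch.symm' (hs : ∀ a b, adj a b → adj b a) {A : Set ℕ} {u v : ℕ} (h : Rch adj {u} A v) :
    Rch adj {v} A u := h.back hs _ (.base v rfl h.mem)

theorem Rch.hit {S A : Set ℕ} {p v : ℕ} (hp : p ∉ S) (h : Rch adj S A v) :
    Rch adj S (A \ {p}) v ∨ ∃ a, Rch adj S (A \ {p}) a ∧ adj a p := by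
  induction h with
  | base s h1 h2 =>
    exact .inl (.base s h1 ⟨h2, fun h => hp (by rw [Set.mem_singleton_iff] at h; rwa [← h])⟩)
  | step u v h1 h2 h3 ih =>
    rcases ih with ih | ih
    · by_cases hv : v = p
      · exact .inr ⟨u, ih, hv ▸ h2⟩
      · exact .inl (.step u v ih h2 ⟨h3, hv⟩)
    · exact .inr ih

def Rooted (adj : ℕ → ℕ → Prop) (S A : Set ℕ) : Prop := ∀ a ∈ A, Rch adj S A a

theorem Rooted.insert_root {S A : Set ℕ} {u : ℕ} (h : Rooted adj S A) (hu : u ∈ S) :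
    Rooted adj S (insert u A) := by
  rintro a (rfl | ha)
  · exact .base _ hu (Set.mem_insert _ _)
  · exact (h a ha).mono subset_rfl (Set.subset_insert _ _)

theorem Rooted.insert_adj {S A : Set ℕ} {u v : ℕ} (h : Rooted adj S A) (hu : u ∈ A)
    (huv : adj u v) : Rooted adj S (insert v A) := by
  rintro a (rfl | ha)
  · exact .step u _ ((h u hu).mono subset_rfl (Set.subset_insert _ _)) huv (Set.mem_insert _ _)
  · exact (h a ha).mono subset_rfl (Set.subset_insert _ _)

structure Pre (adj : ℕ → ℕ → Prop) (S₁ S₂ : Set ℕ) (q : ℕ) (A B : Set ℕ) : Prop where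
  ra : Rooted adj S₁ A
  rb : Rooted adj S₂ B
  dj : ∀ a, a ∈ A → a ∈ B → False
  qa : q ∉ A
  qb : q ∉ B
  aa : ∃ a ∈ A, adj a q
  ab : ∃ b ∈ B, adj b q

theorem Pre.swap {S₁ S₂ : Set ℕ} {q : ℕ} {A B : Set ℕ} (h : Pre adj S₁ S₂ q A B) :
    Pre adj S₂ S₁ q B A := ⟨h.rb, h.ra, fun a x y => h.dj a y x, h.qb, h.qa, h.ab, h.aa⟩

theorem Pre.insA {S₁ S₂ : Set ℕ} {q v : ℕ} {A B : Set ℕ} (h : Pre adj S₁ S₂ q A B)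
    (hv : v ≠ q) (hb : v ∉ B) (hr : Rooted adj S₁ (insert v A)) :
    Pre adj S₁ S₂ q (insert v A) B := by
  refine ⟨hr, h.rb, ?_, ?_, h.qb, ?_, h.ab⟩
  · rintro a (rfl | ha) hb'
    · exact hb hb'
    · exact h.dj a ha hb'
  · rintro (h' | h')
    · exact hv h'.symm
    · exact h.qa h'
  · obtain ⟨a, ha, h2⟩ := h.aa
    exact ⟨a, .inr ha, h2⟩

theorem Pre.absorb {S₁ S₂ : Set ℕ} {q u : ℕ} {A B : Set ℕ} (h : Pre adj S₁ S₂ q A B)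
    (hu : Rch adj (S₁ ∪ S₂) {q}ᶜ u) :
    ∃ A' B', Pre adj S₁ S₂ q A' B' ∧ (u ∈ A' ∨ u ∈ B') := by
  induction hu with
  | base s h1 h2 =>
    by_cases hA : s ∈ A
    · exact ⟨A, B, h, .inl hA⟩
    by_cases hB : s ∈ B
    · exact ⟨A, B, h, .inr hB⟩
    rcases h1 with h1 | h1
    · exact ⟨_, B, h.insA h2 hB (h.ra.insert_root h1), .inl (Set.mem_insert _ _)⟩
    · exact ⟨A, _, (h.swap.insA h2 hA (h.rb.insert_root h1)).swap, .inr (Set.mem_insert _ _)⟩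
  | step u v h1 h2 h3 ih =>
    obtain ⟨A, B, h, hh⟩ := ih
    by_cases hA : v ∈ A
    · exact ⟨A, B, h, .inl hA⟩
    by_cases hB : v ∈ B
    · exact ⟨A, B, h, .inr hB⟩
    rcases hh with hh | hh
    · exact ⟨_, B, h.insA h3 hB (h.ra.insert_adj hh h2), .inl (Set.mem_insert _ _)⟩
    · exact ⟨A, _, (h.swap.insA h3 hA (h.rb.insert_adj hh h2)).swap, .inr (Set.mem_insert _ _)⟩

theorem Pre.next {S₁ S₂ : Set ℕ} {q p : ℕ} {A B : Set ℕ} (h : Pre adj S₁ S₂ q A B)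
    (hqp : adj q p) (hp : p ∉ S₁) (hpA : p ∈ A) :
    ∃ A' B', Pre adj S₁ S₂ p A' B' := by
  obtain ⟨b, hb, hbq⟩ := h.ab
  refine ⟨{v | Rch adj S₁ (A \ {p}) v}, insert q B, ?_, h.rb.insert_adj hb hbq, ?_, ?_, ?_, ?_, ?_⟩
  · exact fun a ha => Rch.self ha
  · rintro a ha (rfl | hb)
    · exact h.qa (Rch.mem ha).1
    · exact h.dj a (Rch.mem ha).1 hb
  · exact fun hh => (Rch.mem hh).2 rfl
  · rintro (rfl | hh)
    · exact h.qa hpA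
    · exact h.dj p hpA hh
  · rcases (h.ra p hpA).hit hp with hh | hh
    · exact absurd rfl hh.mem.2
    · exact hh
  · exact ⟨q, Set.mem_insert _ _, hqp⟩

theorem Pre.step {S₁ S₂ : Set ℕ} {q p : ℕ} {A B : Set ℕ} (h : Pre adj S₁ S₂ q A B)
    (hqp : adj q p) (hp : p ∉ S₁ ∪ S₂) (hr : Rch adj (S₁ ∪ S₂) {q}ᶜ p) :
    ∃ A' B', Pre adj S₁ S₂ p A' B' := by
  obtain ⟨A, B, h, hh | hh⟩ := h.absorb hr
  · exact h.next hqp (fun h => hp (.inl h)) hh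
  · obtain ⟨A', B', h'⟩ := h.swap.next hqp (fun h => hp (.inr h)) hh
    exact ⟨B', A', h'.swap⟩

theorem Pre.fin' {S₁ S₂ : Set ℕ} {q x y : ℕ} {A B : Set ℕ} (h : Pre adj S₁ S₂ q A B)
    (hx : ¬ Rch adj (S₁ ∪ S₂) {q}ᶜ x) (hx' : Rch adj (S₁ ∪ S₂) Set.univ x) (hy : y ∈ A) :
    ∃ A B, (∀ a, a ∈ A → a ∈ B → False) ∧ Rch adj S₁ A y ∧ Rch adj S₂ B x := by
  refine ⟨A, B ∪ {u | ¬ Rch adj (S₁ ∪ S₂) {q}ᶜ u}, ?_, h.ra y hy, ?_⟩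
  · rintro a ha (hb | hb)
    · exact h.dj a ha hb
    · refine hb ((h.ra a ha).mono Set.subset_union_left ?_)
      rintro c hc rfl
      exact h.qa hc
  · have hq : ¬ Rch adj (S₁ ∪ S₂) {q}ᶜ q := fun h => h.mem rfl
    have key : Rch adj S₂ (B ∪ {u | ¬ Rch adj (S₁ ∪ S₂) {q}ᶜ u}) q := by
      obtain ⟨b, hb, hbq⟩ := h.ab
      exact .step b q ((h.rb b hb).mono subset_rfl Set.subset_union_left) hbq (.inr hq)
    have : ∀ u, Rch adj (S₁ ∪ S₂) Set.univ u → ¬ Rch adj (S₁ ∪ S₂) {q}ᶜ u →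
        Rch adj S₂ (B ∪ {u | ¬ Rch adj (S₁ ∪ S₂) {q}ᶜ u}) u := by
      intro u hu
      induction hu with
      | base s h1 h2 =>
        intro hn
        by_cases hs : s = q
        · exact hs ▸ key
        · exact absurd (.base s h1 hs) hn
      | step u v h1 h2 h3 ih =>
        intro hn
        by_cases hv : v = q
        · exact hv ▸ key
        by_cases hu : Rch adj (S₁ ∪ S₂) {q}ᶜ u
        · exact absurd (.step u v hu h2 hv) hn
        · exact .step u v (ih hu) h2 (.inr hn)
    exact this x hx' hx

def Linked (adj : ℕ → ℕ → Prop) (S₁ S₂ : Set ℕ) (x y : ℕ) : Prop :=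
  ∃ A B : Set ℕ, (∀ a, a ∈ A → a ∈ B → False) ∧ Rch adj S₁ A x ∧ Rch adj S₂ B y

theorem Pre.fin {S₁ S₂ : Set ℕ} {q x y : ℕ} {A B : Set ℕ} (h : Pre adj S₁ S₂ q A B)
    (hx : ¬ Rch adj (S₁ ∪ S₂) {q}ᶜ x) (hx' : Rch adj (S₁ ∪ S₂) Set.univ x)
    (hy : Rch adj (S₁ ∪ S₂) {q}ᶜ y) :
    Linked adj S₁ S₂ x y ∨ Linked adj S₁ S₂ y x := by
  obtain ⟨A, B, h, hh | hh⟩ := h.absorb hy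
  · exact .inr (h.fin' hx hx' hh)
  · rw [Set.union_comm] at hx hx'
    obtain ⟨A', B', h1, h2, h3⟩ := h.swap.fin' hx hx' hh
    exact .inl ⟨B', A', fun a x y => h1 a y x, h3, h2⟩

/-- Abstract form. -/
theorem abs_main (hs : ∀ a b, adj a b → adj b a) (z w z' x y : ℕ) (S : Set ℕ)
    (hleaf : ∀ s, s = z ∨ s ∈ S → ∀ a b, adj s a → adj s b → a = b)
    (hzS : z ∉ S) (hxz : x ≠ z) (hxS : x ∉ S) (hw : w ∈ S)
    (hwc : Rch adj {z} Set.univ w) (hxc : Rch adj {z} Set.univ x)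
    (hz' : adj z z')
    (hl1 : ¬ Linked adj {z} S x y) (hl2 : ¬ Linked adj {z} S y x) :
    ∃ q, (∃ a b, a ≠ b ∧ adj q a ∧ adj q b) ∧
      ¬ Rch adj ({z} ∪ S) {q}ᶜ x ∧ ¬ Rch adj ({z} ∪ S) {q}ᶜ y := by
  have hz'S : z' ∉ S := by
    intro hS
    have : ∀ u, Rch adj {z} Set.univ u → u = z ∨ u = z' := by
      intro u hu
      induction hu with
      | base s h1 h2 => exact .inl h1
      | step u v h1 h2 h3 ih =>
        rcases ih with rfl | rfl
        · exact .inr (hleaf _ (.inl rfl) _ _ h2 hz')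
        · exact .inl (hleaf _ (.inr hS) _ _ h2 (hs _ _ hz'))
    rcases this x hxc with h | h
    · exact hxz h
    · exact hxS (h ▸ hS)
  have hz'z : z' ≠ z := by
    rintro rfl
    have : ∀ u, Rch adj {z'} Set.univ u → u = z' := by
      intro u hu
      induction hu with
      | base s h1 h2 => exact h1
      | step u v h1 h2 h3 ih =>
        rw [ih] at h2
        exact hleaf _ (.inl rfl) _ _ h2 hz'
    exact hxz (this x hxc)
  have hbase : ∃ A B, Pre adj {z} S z' A B := by
    have hB : ∀ a, Rch adj S {z'}ᶜ a → a ≠ z := by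
      intro a ha
      cases ha with
      | base s h1 h2 => rintro rfl; exact hzS h1
      | step u v h1 h2 h3 =>
        rintro rfl
        exact h1.mem (hleaf _ (.inl rfl) _ _ (hs _ _ h2) hz')
    refine ⟨{z}, {v | Rch adj S {z'}ᶜ v}, ?_, fun a ha => Rch.self ha, ?_, hz'z,
      fun h => Rch.mem h rfl, ⟨z, rfl, hz'⟩, ?_⟩
    · intro a ha; exact .base a ha ha
    · intro a ha hb; exact hB a hb ha
    · have h1 : Rch adj S Set.univ z :=
        (hwc.symm' hs).mono (by simpa using hw) subset_rfl
      have h2 : Rch adj S Set.univ z' := .step _ _ h1 hz' trivial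
      have e : (Set.univ \ {z'} : Set ℕ) = {z'}ᶜ := by ext; simp
      rcases h2.hit hz'S with h | h
      · exact absurd rfl h.mem.2
      · rw [e] at h; exact h
  have hgood : ∀ u, Rch adj {z} Set.univ u →
      (∃ q A B, Pre adj {z} S q A B ∧ ¬ Rch adj ({z} ∪ S) {q}ᶜ u) ∨
      (u ∈ ({z} ∪ S : Set ℕ) ∧ ∀ v, adj u v →
        ∃ q A B, Pre adj {z} S q A B ∧ ¬ Rch adj ({z} ∪ S) {q}ᶜ v) := by
    intro u hu
    induction hu with
    | base s h1 h2 =>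
      right
      obtain ⟨A, B, h⟩ := hbase
      refine ⟨.inl h1, fun v hv => ⟨z', A, B, h, ?_⟩⟩
      rw [Set.mem_singleton_iff] at h1
      subst h1
      rw [hleaf s (.inl rfl) v z' hv hz']
      exact fun h => h.mem rfl
    | step u v h1 h2 h3 ih =>
      rcases ih with ⟨q, A, B, hP, hn⟩ | ⟨_, ih⟩
      · by_cases hv : v ∈ ({z} ∪ S : Set ℕ)
        · right
          refine ⟨hv, fun t ht => ?_⟩
          have : t = u := hleaf v hv t u ht (hs _ _ h2)
          rw [this]
          exact ⟨q, A, B, hP, hn⟩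
        · left
          by_cases hr : Rch adj ({z} ∪ S) {q}ᶜ v
          · by_cases hu : u = q
            · subst hu
              obtain ⟨A', B', h'⟩ := hP.step h2 hv hr
              exact ⟨v, A', B', h', fun h => h.mem rfl⟩
            · exact absurd (.step v u hr (hs _ _ h2) hu) hn
          · exact ⟨q, A, B, hP, hr⟩
      · exact .inl (ih v h2)
  rcases hgood x hxc with ⟨q, A, B, hP, hn⟩ | ⟨h, _⟩
  · refine ⟨q, ?_, hn, fun hy => ?_⟩
    · obtain ⟨a, ha, h1⟩ := hP.aa
      obtain ⟨b, hb, h2⟩ := hP.ab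
      exact ⟨a, b, fun h => hP.dj a ha (h ▸ hb), hs _ _ h1, hs _ _ h2⟩
    · rcases hP.fin hn (hxc.mono Set.subset_union_left subset_rfl) hy with h | h
      · exact hl1 h
      · exact hl2 h
  · rcases h with h | h
    · exact absurd h hxz
    · exact absurd h hxS

end abs

def adj (G : DGr) (u v : ℕ) : Prop :=
  ∃ a ∈ G.A, (G.W a = u ∧ G.E a = v) ∨ (G.W a = v ∧ G.E a = u)

theorem adj_symm (G : DGr) (u v : ℕ) (h : G.adj u v) : G.adj v u := by
  obtain ⟨a, ha, h⟩ := h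
  exact ⟨a, ha, h.symm⟩

theorem path_rch (G : DGr) {u v : ℕ} {vs es : List ℕ} (h : G.SemipathFT u v vs es)
    {A : Set ℕ} (hA : ∀ t ∈ vs, t ∈ A) : Rch G.adj {u} A v := by
  obtain ⟨⟨⟨hlen, -, hes, hst⟩, -⟩, hh, hl⟩ := h
  have key : ∀ i t : ℕ, vs[i]? = some t → Rch G.adj {u} A t := by
    intro i
    induction i with
    | zero =>
      intro t ht
      rw [List.head?_eq_getElem?, ht] at hh
      exact .base t (by simpa using hh) (hA t (List.mem_of_getElem? ht))
    | succ i ih =>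
      intro t ht
      have hi : i + 1 < vs.length := (List.getElem?_eq_some_iff.1 ht).1
      have h1 : vs[i]? = some (vs[i]'(by omega)) := List.getElem?_eq_getElem _
      have h2 : es[i]? = some (es[i]'(by omega)) := List.getElem?_eq_getElem _
      exact .step _ t (ih _ h1) ⟨_, hes _ (List.mem_of_getElem? h2), hst i _ _ _ h2 h1 ht⟩
        (hA t (List.mem_of_getElem? ht))
  rw [List.getLast?_eq_getElem?] at hl
  exact key _ _ hl

theorem rch_path (G : DGr) (hwf : G.WellFormed) {S A : Set ℕ} {v : ℕ} (hS : ∀ s ∈ S, s ∈ G.V)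
    (h : Rch G.adj S A v) : ∃ s ∈ S, ∃ vs es, G.SemipathFT v s vs es ∧ ∀ t ∈ vs, t ∈ A := by
  induction h with
  | base s h1 h2 =>
    refine ⟨s, h1, [s], [], ⟨⟨⟨rfl, ?_, ?_, ?_⟩, ?_⟩, rfl, rfl⟩, ?_⟩
    · simpa using hS s h1
    · simp
    · simp
    · simp
    · simpa using h2
  | step u v h1 h2 h3 ih =>
    obtain ⟨s, hs, vs, es, ⟨⟨⟨hlen, hV, hes, hst⟩, hnd⟩, hh, hl⟩, hA⟩ := ih
    by_cases hv : v ∈ vs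
    · obtain ⟨i, hi, rfl⟩ := List.getElem_of_mem hv
      refine ⟨s, hs, vs.drop i, es.drop i, ⟨⟨⟨?_, ?_, ?_, ?_⟩, ?_⟩, ?_, ?_⟩, ?_⟩
      · simp; omega
      · exact fun t ht => hV t (List.mem_of_mem_drop ht)
      · exact fun t ht => hes t (List.mem_of_mem_drop ht)
      · intro j a p q ha hp hq
        rw [List.getElem?_drop] at ha hp hq
        exact hst _ _ _ _ ha hp hq
      · exact hnd.sublist (List.drop_sublist _ _)
      · rw [List.head?_drop, List.getElem?_eq_getElem hi]
      · rw [List.getLast?_drop, if_neg (by omega)]; exact hl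
      · exact fun t ht => hA t (List.mem_of_mem_drop ht)
    · obtain ⟨a, ha, hav⟩ := h2
      refine ⟨s, hs, v :: vs, a :: es, ⟨⟨⟨?_, ?_, ?_, ?_⟩, ?_⟩, ?_, ?_⟩, ?_⟩
      · simp [hlen]
      · intro t ht
        rcases List.mem_cons.1 ht with rfl | ht
        · rcases hav with h | h
          · exact h.2 ▸ (hwf a ha).2
          · exact h.1 ▸ (hwf a ha).1
        · exact hV t ht
      · intro t ht
        rcases List.mem_cons.1 ht with rfl | ht
        · exact ha
        · exact hes t ht
      · intro j b p q hb hp hq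
        cases j with
        | zero =>
          rw [List.head?_eq_getElem?] at hh
          simp only [List.getElem?_cons_zero, List.getElem?_cons_succ, Option.some.injEq, hh,
            zero_add] at hb hp hq
          subst hb hp hq
          exact hav.symm
        | succ j =>
          simp only [List.getElem?_cons_succ] at hb hp hq
          exact hst _ _ _ _ hb hp hq
      · exact List.nodup_cons.2 ⟨hv, hnd⟩
      · rfl
      · rw [List.getLast?_cons, hl]; rfl
      · intro t ht
        rcases List.mem_cons.1 ht with rfl | ht
        · exact h3
        · exact hA t ht

theorem conn_rch (G : DGr) (hc : G.WeaklyConnected) {u v : ℕ} (hu : u ∈ G.V) (hv : v ∈ G.V) :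
    Rch G.adj {u} Set.univ v := by
  by_cases h : u = v
  · exact .base v h.symm trivial
  · obtain ⟨vs, es, hp⟩ := hc u hu v hv h
    exact G.path_rch hp (fun _ _ => trivial)

theorem xv_leaf (G : DGr) (hf : G.WEFunctional) {X : Bool} {s : ℕ} (hs : G.XVertex X s) :
    ∀ a b, G.adj s a → G.adj s b → a = b := by
  rintro a b ⟨e, he, h1⟩ ⟨f, hf', h2⟩
  have n1 := hs.2 e he
  have n2 := hs.2 f hf'
  have key := hf X e
  have : e = f := by
    by_contra hne
    cases X
    · have e1 : G.E e = s := by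
        rcases h1 with h | h
        · exact absurd h.1 n1
        · exact h.2
      have e2 : G.E f = s := by
        rcases h2 with h | h
        · exact absurd h.1 n2
        · exact h.2
      refine key ⟨he, ?_⟩ f hf' (fun h => hne h.symm) (e2.trans e1.symm)
      show G.XVertex false (G.E e)
      rw [e1]; exact hs
    · have e1 : G.W e = s := by
        rcases h1 with h | h
        · exact h.1
        · exact absurd h.2 n1
      have e2 : G.W f = s := by
        rcases h2 with h | h
        · exact h.1
        · exact absurd h.2 n2
      refine key ⟨he, ?_⟩ f hf' (fun h => hne h.symm) (e2.trans e1.symm)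
      show G.XVertex true (G.W e)
      rw [e1]; exact hs
  subst this
  cases X
  · rcases h1 with h1 | h1
    · exact absurd h1.1 n1
    rcases h2 with h2 | h2
    · exact absurd h2.1 n2
    exact h1.1.symm.trans h2.1
  · rcases h1 with h1 | h1
    · rcases h2 with h2 | h2
      · exact h1.2.symm.trans h2.2
      · exact absurd h2.2 n2
    · exact absurd h1.2 n1

theorem xv_nbr (G : DGr) (hc : G.WeaklyConnected) {u v : ℕ} (hu : u ∈ G.V) (hv : v ∈ G.V)
    (h : u ≠ v) : ∃ u', G.adj u u' := by
  have := G.conn_rch hc hv hu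
  cases this with
  | base s h1 h2 => exact absurd h1 h
  | step t _ h1 h2 h3 => exact ⟨t, G.adj_symm _ _ h2⟩

/-- E-vertices with an edge are not W-vertices. -/
theorem not_both (G : DGr) (hc : G.WeaklyConnected) {u v : ℕ} (hu : G.XVertex false u)
    (hv : v ∈ G.V) (h : u ≠ v) : ¬ G.XVertex true u := by
  intro hw
  obtain ⟨u', a, ha, h1⟩ := G.xv_nbr hc hu.1 hv h
  rcases h1 with h1 | h1
  · exact hu.2 a ha h1.1
  · exact hw.2 a ha h1.2

end DGr

/-- **Theorem 3.4.1** (the Pivot Theorem): if `x`, `y`, `z` are distinct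
E-vertices of a D-graph with `ψ_E(x,y,z)` and `ψ_E(y,x,z)`, then there is a
vertex `v` with `v ▷ [z,x]`, `v ▷ [z,y]`, `v ≺ x` and `v ≺ y`. -/
theorem pivot_theorem (G : DGr) (hG : G.IsDGraph) (x y z : ℕ)
    (hx : G.XVertex false x) (hy : G.XVertex false y) (hz : G.XVertex false z)
    (hxy : x ≠ y) (hxz : x ≠ z) (hyz : y ≠ z)
    (h1 : G.psi false x y z) (h2 : G.psi false y x z) :
    ∃ v, G.inAll v z x ∧ G.inAll v z y ∧ G.Pivot v x ∧ G.Pivot v y := by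
  obtain ⟨hwf, -, hf, hc, -⟩ := hG
  have hsy := G.adj_symm
  obtain ⟨z', hz'⟩ := G.xv_nbr hc hz.1 hx.1 hxz.symm
  by_cases hW : ∃ w, G.XVertex true w
  · obtain ⟨w, hw⟩ := hW
    have hl : ∀ u v, G.psi false u v z → ¬ DGr.Linked G.adj {z} {t | G.XVertex true t} u v := by
      rintro u v hp ⟨A, B, hd, hA, hB⟩
      obtain ⟨s, hs, vs, es, hpa, hAA⟩ := G.rch_path hwf (by simpa using hz.1) hA
      obtain ⟨t, ht, vs', es', hpb, hBB⟩ := G.rch_path hwf (fun s hs => hs.1) hB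
      rw [Set.mem_singleton_iff] at hs
      subst hs
      obtain ⟨r, hr1, hr2⟩ := hp vs es hpa t vs' es' ht hpb
      exact hd r (hAA r hr1) (hBB r hr2)
    obtain ⟨q, ⟨a, b, hab, ha, hb⟩, hnx, hny⟩ :=
      DGr.abs_main hsy z w z' x y {t | G.XVertex true t}
        (by
          rintro s (rfl | hs)
          · exact G.xv_leaf hf hz
          · exact G.xv_leaf hf hs)
        (G.not_both hc hz hx.1 hxz.symm) hxz (G.not_both hc hx hz.1 hxz) hw
        (G.conn_rch hc hz.1 hw.1) (G.conn_rch hc hz.1 hx.1) hz' (hl x y h1) (hl y x h2)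
    have hall : ∀ u, ¬ DGr.Rch G.adj ({z} ∪ {t | G.XVertex true t}) {q}ᶜ u → G.inAll q z u := by
      intro u hn vs es hp
      by_contra hq
      exact hn ((G.path_rch hp (A := {q}ᶜ) (by rintro t ht rfl; exact hq ht)).mono
        Set.subset_union_left subset_rfl)
    have hpiv : ∀ u, G.XVertex false u →
        ¬ DGr.Rch G.adj ({z} ∪ {t | G.XVertex true t}) {q}ᶜ u → G.Pivot q u := by
      intro u hu hn
      refine ⟨?_, ?_⟩
      · rintro rfl
        exact hab (G.xv_leaf hf hu a b ha hb)
      · intro t vs es ht hp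
        by_contra hq
        refine hn (((G.path_rch hp (A := {q}ᶜ) (by rintro t ht rfl; exact hq ht)).symm' hsy).mono
          ?_ subset_rfl)
        rintro r rfl
        exact .inr ht
    exact ⟨q, hall x hnx, hall y hny, hpiv x hx hnx, hpiv y hy hny⟩
  · have hne : ∀ u, G.XVertex false u → z' ≠ u := by
      rintro u hu rfl
      obtain ⟨e, he, h | h⟩ := hz'
      · exact hz.2 e he h.1
      · exact hu.2 e he h.1
    have hall : ∀ u, u ≠ z → G.inAll z' z u := by
      intro u hu vs es hp
      by_contra hq
      have hr := G.path_rch hp (A := {z'}ᶜ) (by rintro t ht rfl; exact hq ht)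
      have : ∀ v, DGr.Rch G.adj {z} {z'}ᶜ v → v = z := by
        intro v hv
        induction hv with
        | base s h1 h2 => exact h1
        | step s t h1 h2 h3 ih =>
          rw [ih] at h2
          exact absurd (G.xv_leaf hf hz _ _ h2 hz') h3
      exact hu (this u hr)
    exact ⟨z', hall x hxz, hall y hyz, ⟨hne x hx, fun t _ _ ht => absurd ⟨t, ht⟩ hW⟩,
      ⟨hne y hy, fun t _ _ ht => absurd ⟨t, ht⟩ hW⟩⟩
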